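/- Let μ : U → ℂ be smooth on open U ⊆ ℂ with μ_z̄ defined (Wirtinger derivative), and let f : U → ℂ be smooth, not identically zero on any open subset, satisfying μ̄ = −2 f_z̄/f wherever f ≠ 0 (i.e., μ̄ f = −2 f_z̄ everywhere). Then the function μ̄_z · f² = −2(f_z̄ f)_z + 4 f_z̄ f_z everywhere on U; in particular μ̄_z·f² extends smoothly across the zeros of f. -/

import Mathlib

/-- The Wirtinger derivative ∂/∂z. -/
noncomputable def wderivZ {E : Type*} [NormedAddCommGroup E] [NormedSpace ℂ E]
    (f : ℂ → E) (z : ℂ) : E :=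
  (2 : ℂ)⁻¹ • (fderiv ℝ f z 1 - Complex.I • fderiv ℝ f z Complex.I)

/-- The Wirtinger derivative ∂/∂z̄. -/
noncomputable def wderivZbar {E : Type*} [NormedAddCommGroup E] [NormedSpace ℂ E]
    (f : ℂ → E) (z : ℂ) : E :=
  (2 : ℂ)⁻¹ • (fderiv ℝ f z 1 + Complex.I • fderiv ℝ f z Complex.I)

theorem Filter.EventuallyEq.wderivZ_eq {E : Type*} [NormedAddCommGroup E] [NormedSpace ℂ E]
    {f g : ℂ → E} {z : ℂ} (h : f =ᶠ[nhds z] g) : wderivZ f z = wderivZ g z := by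
  rw [wderivZ, wderivZ, h.fderiv_eq]

theorem wderivZ_mul {f g : ℂ → ℂ} {z : ℂ} (hf : DifferentiableAt ℝ f z)
    (hg : DifferentiableAt ℝ g z) :
    wderivZ (fun t => f t * g t) z = wderivZ f z * g z + f z * wderivZ g z := by
  simp only [wderivZ, fderiv_fun_mul hf hg, add_apply, smul_apply,
    smul_eq_mul]
  ring

theorem wderivZ_const (c z : ℂ) : wderivZ (fun _ => c) z = 0 := by
  simp [wderivZ]

/-- Key computation of Proposition 5.3: if μ̄ f = −2 f_z̄, then
μ̄_z f² = −2(f_z̄ f)_z + 4 f_z̄ f_z, so μ̄_z f² extends smoothly across the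
zeros of f. -/
theorem stmt_19 (U : Set ℂ) (hU : IsOpen U) (μ f : ℂ → ℂ)
    (hμ : ContDiffOn ℝ (⊤ : ℕ∞) μ U) (hf : ContDiffOn ℝ (⊤ : ℕ∞) f U)
    (hne : ∀ V : Set ℂ, IsOpen V → V.Nonempty → V ⊆ U → ∃ z ∈ V, f z ≠ 0)
    (heq : ∀ z ∈ U, (starRingEnd ℂ) (μ z) * f z = -2 * wderivZbar f z) :
    ∀ z ∈ U,
      wderivZ (fun t => (starRingEnd ℂ) (μ t)) z * (f z) ^ 2
        = -2 * wderivZ (fun t => wderivZbar f t * f t) z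
          + 4 * wderivZbar f z * wderivZ f z := by
  intro z hz
  have hUz : U ∈ nhds z := hU.mem_nhds hz
  have hfz : DifferentiableAt ℝ f z := (hf.contDiffAt hUz).differentiableAt (by simp)
  have hμz : DifferentiableAt ℝ (fun t => (starRingEnd ℂ) (μ t)) z :=
    Complex.conjCLE.differentiableAt.comp z ((hμ.contDiffAt hUz).differentiableAt (by simp))
  have hprod : (fun t => wderivZbar f t * f t) =ᶠ[nhds z]
      fun t => (-(2 : ℂ)⁻¹) * ((starRingEnd ℂ) (μ t) * (f t * f t)) := by
    filter_upwards [hUz] with t ht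
    linear_combination (2 : ℂ)⁻¹ * f t * heq t ht
  rw [hprod.wderivZ_eq,
    wderivZ_mul (differentiableAt_const _) (hμz.fun_mul (hfz.fun_mul hfz)), wderivZ_const,
    wderivZ_mul hμz (hfz.fun_mul hfz), wderivZ_mul hfz hfz]
  linear_combination -2 * wderivZ f z * heq z hz
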